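/- arXiv:0807.1496 — 2 statements merged into one kernel-verified Lean document; each statement's English description precedes it below -/
import Mathlib

section
/- Let T be a uniformly random spanning tree of a connected graph G. Then for every edge (u,v) of G, the probability that (u,v) belongs to T is at least 1/d(u), where d(u) is the degree of u in G. -/
open Finset
open scoped Classical

/-- The set of spanning trees of a graph `G` on a finite vertex set. -/
noncomputable def spanningTrees {V : Type*} [Fintype V] [DecidableEq V]
    (G : SimpleGraph V) : Finset (SimpleGraph V) :=
  Finset.univ.filter (fun T => T ≤ G ∧ T.IsTree)

namespace SimpleGraph

variable {V : Type*} {T : SimpleGraph V} {u v w : V}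

/-- Two vertices joined by a path are still joined, from the second vertex of the path onwards,
after removing the first edge of the path. -/
lemma Reachable.exists_adj_reachable_deleteEdges (h : T.Reachable u v) (huv : u ≠ v) :
    ∃ w, T.Adj u w ∧ (T.deleteEdges {s(u, w)}).Reachable w v := by
  obtain ⟨p, hp⟩ := h.exists_isPath
  cases p with
  | nil => exact absurd rfl huv
  | cons hadj q =>
    refine ⟨_, hadj, reachable_deleteEdges_iff_exists_walk.2 ⟨q, fun hmem => ?_⟩⟩
    exact ((Walk.cons_isPath_iff _ _).1 hp).2 (q.fst_mem_support_of_mem_edges hmem)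

/-- In a tree, the edge `s(u, w)` separates `u` from every vertex on the side of `w`. -/
lemma IsAcyclic.not_reachable_deleteEdges (hT : T.IsAcyclic) (hadj : T.Adj u w)
    (hwv : (T.deleteEdges {s(u, w)}).Reachable w v) :
    ¬ (T.deleteEdges {s(u, w)}).Reachable u v :=
  fun h => isBridge_iff.1 (isAcyclic_iff_forall_adj_isBridge.1 hT hadj) (h.trans hwv.symm)

/-- Exchanging the edge `s(u, w)` of a tree for an edge from `u` to the side of `w` gives a tree. -/
lemma IsTree.deleteEdges_sup_edge (hT : T.IsTree) (hadj : T.Adj u w) (huv : u ≠ v)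
    (hwv : (T.deleteEdges {s(u, w)}).Reachable w v) :
    (T.deleteEdges {s(u, w)} ⊔ edge u v).IsTree := by
  have := hT.connected.nonempty
  have huw : (T.deleteEdges {s(u, w)} ⊔ edge u v).Reachable u w :=
    (Adj.reachable (Or.inr ((edge_adj ..).2 ⟨Or.inl ⟨rfl, rfl⟩, huv⟩))).trans
      (hwv.symm.mono le_sup_left)
  have hstep (a b : V) (hab : T.Adj a b) :
      (T.deleteEdges {s(u, w)} ⊔ edge u v).Reachable a b := by
    by_cases he : s(a, b) = s(u, w)
    · rcases Sym2.eq_iff.1 he with ⟨rfl, rfl⟩ | ⟨rfl, rfl⟩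
      exacts [huw, huw.symm]
    · exact Adj.reachable (Or.inl (deleteEdges_adj.2 ⟨hab, he⟩))
  have hpre : (T.deleteEdges {s(u, w)} ⊔ edge u v).Preconnected := by
    intro a b
    obtain ⟨p⟩ := hT.connected a b
    induction p with
    | nil => rfl
    | cons h _ ih => exact (hstep _ _ h).trans ih
  exact ⟨⟨hpre⟩, (hT.isAcyclic.anti (deleteEdges_le _)).sup_edge_of_not_reachable
    (hT.isAcyclic.not_reachable_deleteEdges hadj hwv)⟩

lemma deleteEdges_sup_edge_of_not_adj (h : ¬ T.Adj u v) :
    (T ⊔ edge u v).deleteEdges {s(u, v)} = T := by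
  ext a b
  simp only [deleteEdges_adj, sup_adj, edge_adj, Set.mem_singleton_iff, Sym2.eq_iff]
  grind [T.symm, adj_comm]

lemma deleteEdges_sup_edge_of_adj (h : T.Adj u v) : T.deleteEdges {s(u, v)} ⊔ edge u v = T := by
  ext a b
  simp only [deleteEdges_adj, sup_adj, edge_adj, Set.mem_singleton_iff, Sym2.eq_iff]
  grind [adj_comm, Adj.ne]

end SimpleGraph

lemma mem_spanningTrees {V : Type*} [Fintype V] [DecidableEq V] {G T : SimpleGraph V} :
    T ∈ spanningTrees G ↔ T ≤ G ∧ T.IsTree := by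
  simp [spanningTrees]

/-- Exchanging the first edge of the path from `u` to `v` for the edge `s(u, v)` maps spanning
trees to spanning trees through `s(u, v)`, and the fibres have at most `G.degree u` elements. -/
lemma card_spanningTrees_le_degree_mul {V : Type*} [Fintype V] [DecidableEq V]
    {G : SimpleGraph V} {u v : V} (huv : G.Adj u v) :
    (spanningTrees G).card ≤
      G.degree u * ((spanningTrees G).filter (fun T => T.Adj u v)).card := by
  have hex (T : SimpleGraph V) : ∃ w, T ∈ spanningTrees G →
      T.Adj u w ∧ (T.deleteEdges {s(u, w)}).Reachable w v := by
    by_cases hT : T ∈ spanningTrees G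
    · obtain ⟨w, hw⟩ := ((mem_spanningTrees.1 hT).2.connected u v).exists_adj_reachable_deleteEdges
        huv.ne
      exact ⟨w, fun _ => hw⟩
    · exact ⟨u, fun h => absurd h hT⟩
  choose f hf using hex
  rw [← SimpleGraph.card_neighborFinset_eq_degree, ← Finset.card_product]
  refine Finset.card_le_card_of_injOn
    (fun T => (f T, T.deleteEdges {s(u, f T)} ⊔ SimpleGraph.edge u v)) ?_ ?_
  · intro T hT
    obtain ⟨hle, htree⟩ := mem_spanningTrees.1 hT
    obtain ⟨hadj, hreach⟩ := hf T hT
    have hedge : (SimpleGraph.edge u v).Adj u v :=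
      (SimpleGraph.edge_adj ..).2 ⟨Or.inl ⟨rfl, rfl⟩, huv.ne⟩
    simp only [Finset.coe_product, Set.mem_prod, Finset.mem_coe, SimpleGraph.mem_neighborFinset,
      Finset.mem_filter, mem_spanningTrees]
    exact ⟨hle hadj, ⟨sup_le ((SimpleGraph.deleteEdges_le _).trans hle)
      ((SimpleGraph.edge_le_iff G).2 (Or.inr huv)),
      htree.deleteEdges_sup_edge hadj huv.ne hreach⟩, Or.inr hedge⟩
  · have hrec (T : SimpleGraph V) (hT : T ∈ spanningTrees G) :
        (T.deleteEdges {s(u, f T)} ⊔ SimpleGraph.edge u v).deleteEdges {s(u, v)} ⊔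
          SimpleGraph.edge u (f T) = T := by
      obtain ⟨hadj, hreach⟩ := hf T hT
      rw [SimpleGraph.deleteEdges_sup_edge_of_not_adj fun h =>
        (mem_spanningTrees.1 hT).2.isAcyclic.not_reachable_deleteEdges hadj hreach h.reachable,
        SimpleGraph.deleteEdges_sup_edge_of_adj hadj]
    intro T hT T' hT' heq
    obtain ⟨hw, hE⟩ := Prod.mk.inj heq
    rw [← hrec T hT, ← hrec T' hT', hE, hw]

/-- In a uniformly random spanning tree of a connected graph `G`, each edge `(u,v)`
is present with probability at least `1 / d(u)`. -/
theorem uniform_spanning_tree_edge_prob_ge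
    {V : Type*} [Fintype V] [DecidableEq V] (G : SimpleGraph V)
    (hG : G.Connected) (u v : V) (huv : G.Adj u v) :
    1 / (G.degree u : ℝ) ≤
      (((spanningTrees G).filter (fun T => T.Adj u v)).card : ℝ) /
        ((spanningTrees G).card : ℝ) := by
  obtain ⟨T, hle, hT⟩ := hG.exists_isTree_le
  have hpos : 0 < (spanningTrees G).card :=
    Finset.card_pos.2 ⟨T, mem_spanningTrees.2 ⟨hle, hT⟩⟩
  have hdeg : 0 < G.degree u := (G.degree_pos_iff_exists_adj u).2 ⟨v, huv⟩
  rw [div_le_div_iff₀ (by exact_mod_cast hdeg) (by exact_mod_cast hpos), one_mul, mul_comm]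
  exact_mod_cast card_spanningTrees_le_degree_mul huv
end

section
/- Let T be a uniformly random spanning tree of K_n, let A be a set of a vertices with a ≤ n/12, and let A' be a disjoint set of ⌊ca⌋ vertices, where c > 0. Then the probability that every neighbor in T of a vertex of A lies in A ∪ A' is at most (2(1+c)a/n)^a. -/
open Finset
open scoped Classical

/-- A parent map of a tree rooted at `r`: the root is fixed and iterating from any vertex
reaches the root. -/
def IsRootedMap {V : Type*} (r : V) (p : V → V) : Prop :=
  p r = r ∧ ∀ v, ∃ k, p^[k] v = r

namespace IsRootedMap

variable {V : Type*} {r : V} {p : V → V}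

theorem exists_depth (hp : IsRootedMap r p) : ∃ d : V → ℕ, ∀ v, v ≠ r → d (p v) < d v := by
  refine ⟨fun v => Nat.find (hp.2 v), fun v hv => ?_⟩
  have hspec := Nat.find_spec (hp.2 v)
  obtain ⟨m, hm⟩ : ∃ m, Nat.find (hp.2 v) = m + 1 := by
    refine Nat.exists_eq_succ_of_ne_zero fun h0 => hv ?_
    rwa [h0] at hspec
  rw [hm, Function.iterate_succ_apply] at hspec
  have := Nat.find_min' (hp.2 (p v)) hspec
  change Nat.find (hp.2 (p v)) < Nat.find (hp.2 v)
  omega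

theorem of_depth (hr : p r = r) (d : V → ℕ) (hd : ∀ v, v ≠ r → d (p v) < d v) :
    IsRootedMap r p := by
  refine ⟨hr, fun v => ?_⟩
  induction h : d v using Nat.strong_induction_on generalizing v with
  | _ m ih =>
    by_cases hv : v = r
    · exact ⟨0, hv⟩
    · obtain ⟨k, hk⟩ := ih _ (h ▸ hd v hv) (p v) rfl
      exact ⟨k + 1, hk⟩

theorem induct (hp : IsRootedMap r p) {P : V → Prop} (root : P r)
    (step : ∀ v, v ≠ r → P (p v) → P v) (v : V) : P v := by
  obtain ⟨d, hd⟩ := hp.exists_depth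
  induction h : d v using Nat.strong_induction_on generalizing v with
  | _ m ih =>
    by_cases hv : v = r
    · exact hv ▸ root
    · exact step v hv (ih _ (h ▸ hd v hv) (p v) rfl)

end IsRootedMap

/-- The graph joining every vertex to its image under `p`. -/
def parentGraph {V : Type*} (p : V → V) : SimpleGraph V where
  Adj u v := u ≠ v ∧ (p u = v ∨ p v = u)
  symm := ⟨fun _ _ h => ⟨h.1.symm, h.2.symm⟩⟩
  loopless := ⟨fun _ h => h.1 rfl⟩

theorem IsRootedMap.isTree_parentGraph {V : Type*} [Fintype V] {r : V} {p : V → V}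
    (hp : IsRootedMap r p) : (parentGraph p).IsTree := by
  have hreach : ∀ v, (parentGraph p).Reachable v r := by
    refine hp.induct (SimpleGraph.Reachable.refl r) fun v _ ih => ?_
    by_cases h : v = p v
    · rwa [← h] at ih
    · exact SimpleGraph.Reachable.trans (SimpleGraph.Adj.reachable ⟨h, Or.inl rfl⟩) ih
  have hconn : (parentGraph p).Connected :=
    { preconnected := fun u v => (hreach u).trans (hreach v).symm
      nonempty := ⟨r⟩ }
  refine SimpleGraph.isTree_iff_connected_and_card.2 ⟨hconn, le_antisymm ?_
    hconn.card_vert_le_card_edgeSet_add_one⟩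
  have hsub : (parentGraph p).edgeFinset ⊆ (univ.erase r).image fun v => s(v, p v) := by
    intro e
    induction e using Sym2.ind with
    | _ u v =>
      rw [SimpleGraph.mem_edgeFinset, SimpleGraph.mem_edgeSet]
      rintro ⟨hne, h | h⟩
      · refine mem_image.2 ⟨u, mem_erase.2 ⟨?_, mem_univ _⟩, by rw [h]⟩
        rintro rfl
        exact hne (hp.1.symm.trans h)
      · refine mem_image.2 ⟨v, mem_erase.2 ⟨?_, mem_univ _⟩, by rw [h, Sym2.eq_swap]⟩
        rintro rfl
        exact hne (h.symm.trans hp.1)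
  have hcard := (card_le_card hsub).trans card_image_le
  rw [card_erase_of_mem (mem_univ r), card_univ] at hcard
  have hpos : 0 < Fintype.card V := Fintype.card_pos_iff.2 ⟨r⟩
  rw [Nat.card_eq_fintype_card, ← SimpleGraph.edgeFinset_card, Nat.card_eq_fintype_card]
  omega

theorem IsRootedMap.parentGraph_injective {V : Type*} {r : V} {p q : V → V}
    (hp : IsRootedMap r p) (hq : IsRootedMap r q) (h : parentGraph p = parentGraph q) :
    p = q := by
  funext v
  obtain ⟨d, hd⟩ := hp.exists_depth
  refine hp.induct (P := fun v => p v = q v) (hp.1.trans hq.1.symm) (fun v hv ih => ?_) v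
  by_contra hne
  have hvw : v ≠ p v := fun e => by
    have := hd v hv
    rw [← e] at this
    exact lt_irrefl _ this
  have hadj : (parentGraph q).Adj v (p v) := h ▸ ⟨hvw, Or.inl rfl⟩
  rcases hadj.2 with h' | h'
  · exact hne h'.symm
  · rw [← ih] at h'
    have hw : p v ≠ r := fun e => by
      rw [e, hp.1] at h'
      exact hv h'.symm
    have h1 := hd v hv
    have h2 := hd _ hw
    rw [h'] at h2
    exact lt_asymm h1 h2

theorem SimpleGraph.IsTree.exists_eq_parentGraph {V : Type*} [Fintype V] {T : SimpleGraph V}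
    (hT : T.IsTree) (r : V) :
    ∃ p : V → V, IsRootedMap r p ∧ parentGraph p = T := by
  have hstep : ∀ v, v ≠ r → ∃ u, T.Adj v u ∧ T.dist u r < T.dist v r := by
    intro v hv
    obtain ⟨w, hw⟩ := hT.connected.exists_walk_length_eq_dist v r
    obtain ⟨u, hadj, w', rfl⟩ := SimpleGraph.Walk.exists_eq_cons_of_ne hv w
    refine ⟨u, hadj, ?_⟩
    rw [← hw, SimpleGraph.Walk.length_cons]
    exact Nat.lt_succ_of_le (SimpleGraph.dist_le w')
  choose f hadj hdist using hstep
  let p : V → V := fun v => if hv : v = r then r else f v hv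
  have hpr : p r = r := dif_pos rfl
  have hpv : ∀ v (hv : v ≠ r), p v = f v hv := fun v hv => dif_neg hv
  have hp : IsRootedMap r p := .of_depth hpr (fun v => T.dist v r) fun v hv => by
    rw [hpv v hv]
    exact hdist v hv
  refine ⟨p, hp, ?_⟩
  have hedge : ∀ u, u ≠ p u → T.Adj u (p u) := by
    intro u hu
    have hur : u ≠ r := fun e => hu (by rw [e, hpr])
    rw [hpv u hur]
    exact hadj u hur
  have hle : parentGraph p ≤ T := by
    rintro u v ⟨hne, rfl | rfl⟩
    · exact hedge u hne
    · exact (hedge v hne.symm).symm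
  refine SimpleGraph.edgeFinset_inj.1 (eq_of_subset_of_card_le
    (SimpleGraph.edgeFinset_mono hle) ?_)
  have h1 := hT.card_edgeFinset
  have h2 := hp.isTree_parentGraph.card_edgeFinset
  omega

section Determinant

variable {V : Type*} [Fintype V] [DecidableEq V]

/-- The rows of the Laplacian, grounded at `r`, of the functional graph of `p`. -/
def groundedRow (r v u : V) : V → ℝ :=
  if v = r then Pi.single r 1 else Pi.single v 1 - Pi.single u 1

theorem det_groundedRow (r : V) (p : V → V) (hpr : p r = r) :
    Matrix.det (Matrix.of fun v => groundedRow r v (p v)) =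
      if IsRootedMap r p then 1 else 0 := by
  split_ifs with hp
  · obtain ⟨d, hd⟩ := hp.exists_depth
    have htri : (Matrix.of fun v => groundedRow r v (p v)).BlockTriangular
        fun v => OrderDual.toDual (d v) := by
      intro i j hij
      have hij' : d i < d j := hij
      rw [Matrix.of_apply, groundedRow]
      split_ifs with hi
      · subst hi
        exact Pi.single_eq_of_ne (fun e => by simp [e] at hij') _
      · have h1 : j ≠ i := fun e => by simp [e] at hij'
        have h2 : j ≠ p i := fun e => by
          have := hd i hi
          rw [← e] at this
          omega
        simp [h1, h2]
    rw [htri.det]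
    refine prod_eq_one fun a _ => ?_
    suffices h : Matrix.toSquareBlock (Matrix.of fun v => groundedRow r v (p v))
        (fun v => OrderDual.toDual (d v)) a = 1 by rw [h, Matrix.det_one]
    ext ⟨i, hi⟩ ⟨j, hj⟩
    have hij : d i = d j := OrderDual.toDual.injective (hi.trans hj.symm)
    rw [Matrix.toSquareBlock_def, Matrix.of_apply, Matrix.of_apply, groundedRow, Matrix.one_apply]
    simp only [Subtype.mk.injEq]
    split_ifs with h1 h2 h2
    · subst h1 h2; simp
    · subst h1; exact Pi.single_eq_of_ne (Ne.symm h2) _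
    · subst h2
      have : i ≠ p i := fun e => by
        have := hd i h1
        rw [← e] at this
        omega
      simp [this]
    · have : j ≠ p i := fun e => by
        have := hd i h1
        rw [← e] at this
        omega
      simp [this, Ne.symm h2]
  · obtain ⟨v₀, hv₀⟩ : ∃ v, ∀ k, p^[k] v ≠ r := by
      by_contra! h
      exact hp ⟨hpr, h⟩
    rw [← Matrix.exists_mulVec_eq_zero_iff]
    let x : V → ℝ := fun v => if ∃ k, p^[k] v = r then 0 else 1
    have hxr : x r = 0 := if_pos ⟨0, rfl⟩
    have hxp : ∀ v, v ≠ r → x (p v) = x v := by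
      intro v hv
      have : (∃ k, p^[k] (p v) = r) ↔ ∃ k, p^[k] v = r := by
        constructor
        · rintro ⟨k, hk⟩
          exact ⟨k + 1, hk⟩
        · rintro ⟨_ | k, hk⟩
          · exact absurd hk hv
          · exact ⟨k, hk⟩
      simp only [x, this]
    refine ⟨x, fun h => ?_, ?_⟩
    · have h1 : x v₀ = 1 := if_neg fun ⟨k, hk⟩ => hv₀ k hk
      rw [h] at h1
      simp at h1
    · ext v
      change groundedRow r v (p v) ⬝ᵥ x = 0
      rw [groundedRow]
      split_ifs with hv
      · simp [hxr]
      · simp [sub_dotProduct, hxp v hv]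

/-- The vertices allowed as parent of `v` when the parents of `A` have to lie in `X`. -/
def allowedParents (A X : Finset V) (r v : V) : Finset V :=
  if v = r then {r} else if v ∈ A then X else univ

theorem card_rootedMap_eq_det (A X : Finset V) (r : V) :
    (((Fintype.piFinset (allowedParents A X r)).filter (IsRootedMap r)).card : ℝ) =
      Matrix.det (Matrix.of fun v => ∑ u ∈ allowedParents A X r v, groundedRow r v u) := by
  have hexp := (Matrix.detRowAlternating (R := ℝ) (n := V)).toMultilinearMap.map_sum_finset
    (fun v u => groundedRow r v u) (allowedParents A X r)
  refine Eq.trans ?_ hexp.symm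
  rw [card_filter, Nat.cast_sum]
  refine sum_congr rfl fun p hp => ?_
  have hpr : p r = r := by
    have := Fintype.mem_piFinset.1 hp r
    simpa [allowedParents] using this
  refine Eq.trans ?_ (det_groundedRow r p hpr).symm
  push_cast
  rfl

theorem card_rootedMap (A X : Finset V) (r : V) (hAX : A ⊆ X) (hrX : r ∈ X) (hrA : r ∉ A) :
    (((Fintype.piFinset (allowedParents A X r)).filter (IsRootedMap r)).card : ℝ) *
        (Fintype.card V : ℝ) ^ (A.card + 1) =
      (X.card : ℝ) ^ A.card * (Fintype.card V : ℝ) ^ (Fintype.card V - 1) := by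
  have hn : (Fintype.card V : ℝ) ≠ 0 :=
    Nat.cast_ne_zero.2 (Fintype.card_pos_iff.2 ⟨r⟩).ne'
  have hX : (X.card : ℝ) ≠ 0 := Nat.cast_ne_zero.2 (card_pos.2 ⟨r, hrX⟩).ne'
  let d : V → ℝ := fun v => if v = r then 1 else if v ∈ A then X.card else Fintype.card V
  let D : Finset V := (insert r A)ᶜ
  let B : Matrix V (Fin 2) ℝ := Matrix.of fun v => ![if v ∈ A then (X.card : ℝ)⁻¹ else 0,
    if v ∈ D then (Fintype.card V : ℝ)⁻¹ else 0]
  let C : Matrix (Fin 2) V ℝ := Matrix.of ![fun u => if u ∈ X then 1 else 0, fun _ => 1]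
  have hfact : (Matrix.of fun v => ∑ u ∈ allowedParents A X r v, groundedRow r v u) =
      Matrix.diagonal d * (1 - B * C) := by
    ext v u
    rw [Matrix.diagonal_mul, Matrix.of_apply, Finset.sum_apply, Matrix.sub_apply, Matrix.one_apply,
      Matrix.mul_apply, Fin.sum_univ_two]
    by_cases hv : v = r
    · subst hv
      simp [allowedParents, groundedRow, d, B, C, hrA, D, Pi.single_apply, eq_comm]
    · have hrv : ¬r = v := fun e => hv e.symm
      by_cases hvA : v ∈ A
      · simp [allowedParents, groundedRow, d, B, C, hv, hrv, hvA, D, Pi.single_apply, mul_sub, hX,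
          eq_comm]
      · simp [allowedParents, groundedRow, d, B, C, hv, hrv, hvA, D, Pi.single_apply, mul_sub, hn,
          eq_comm]
  have hcardD : (D.card : ℝ) = Fintype.card V - (A.card + 1) := by
    have := card_compl_add_card (insert r A)
    rw [card_insert_of_notMem hrA] at this
    rw [eq_sub_iff_add_eq]
    exact_mod_cast this
  have hXD : ((D ∩ X).card : ℝ) = X.card - (A.card + 1) := by
    have h1 : D ∩ X = X \ insert r A := by ext; simp [D, and_comm, and_assoc]
    have h2 := card_sdiff_add_card_eq_card (insert_subset hrX hAX)
    rw [card_insert_of_notMem hrA] at h2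
    rw [h1, eq_sub_iff_add_eq]
    exact_mod_cast h2
  have hAX' : A ∩ X = A := inter_eq_left.2 hAX
  have hdet : Matrix.det (1 - B * C) = (Fintype.card V : ℝ)⁻¹ := by
    rw [Matrix.det_one_sub_mul_comm, Matrix.det_fin_two]
    have h00 : (C * B) 0 0 = A.card * (X.card : ℝ)⁻¹ := by
      simp [Matrix.mul_apply, B, C, hAX']
    have h01 : (C * B) 0 1 = (D ∩ X).card * (Fintype.card V : ℝ)⁻¹ := by
      simp [Matrix.mul_apply, B, C]
    have h10 : (C * B) 1 0 = A.card * (X.card : ℝ)⁻¹ := by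
      simp [Matrix.mul_apply, B, C]
    have h11 : (C * B) 1 1 = D.card * (Fintype.card V : ℝ)⁻¹ := by
      simp [Matrix.mul_apply, B, C]
    simp only [Matrix.sub_apply, h00, h01, h10, h11, hcardD, hXD]
    simp
    field_simp
    ring
  have hprod : ∏ v, d v = (X.card : ℝ) ^ A.card * (Fintype.card V : ℝ) ^ D.card := by
    rw [← prod_compl_mul_prod (insert r A), prod_insert hrA]
    have h1 : ∏ v ∈ (insert r A)ᶜ, d v = (Fintype.card V : ℝ) ^ D.card := by
      refine prod_eq_pow_card fun v hv => ?_
      simp only [mem_compl, mem_insert, not_or] at hv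
      simp [d, hv]
    have h2 : ∏ v ∈ A, d v = (X.card : ℝ) ^ A.card := by
      refine prod_eq_pow_card fun v hv => ?_
      have : v ≠ r := fun e => hrA (e ▸ hv)
      simp [d, hv, this]
    rw [h1, h2]
    simp [d, mul_comm]
  have hexp : Fintype.card V - 1 = D.card + A.card := by
    have : D.card + (insert r A).card = Fintype.card V := card_compl_add_card _
    rw [card_insert_of_notMem hrA] at this
    omega
  rw [card_rootedMap_eq_det, hfact, Matrix.det_mul, Matrix.det_diagonal, hdet, hprod, hexp]
  field_simp
  ring

end Determinant

section SpanningTrees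

variable {V : Type*} [Fintype V] [DecidableEq V]

theorem mem_spanningTrees_top {T : SimpleGraph V} :
    T ∈ spanningTrees (⊤ : SimpleGraph V) ↔ T.IsTree := by
  simp [spanningTrees]

theorem card_rootedMap_le_card_spanningTrees (A X : Finset V) (r : V) :
    ((Fintype.piFinset (allowedParents A X r)).filter (IsRootedMap r)).card ≤
      (spanningTrees (⊤ : SimpleGraph V)).card := by
  refine card_le_card_of_injOn parentGraph (fun p hp => ?_) fun p hp q hq h => ?_
  · exact mem_spanningTrees_top.2 (mem_filter.1 hp).2.isTree_parentGraph
  · exact (mem_filter.1 hp).2.parentGraph_injective (mem_filter.1 hq).2 h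

theorem card_confined_le_card_rootedMap (A X : Finset V) (r : V) (hAX : A ⊆ X) :
    ((spanningTrees (⊤ : SimpleGraph V)).filter
        (fun T => ∀ u ∈ A, ∀ v : V, T.Adj u v → v ∈ X)).card ≤
      ((Fintype.piFinset (allowedParents A X r)).filter (IsRootedMap r)).card := by
  refine card_le_card_of_surjOn parentGraph fun T hT => ?_
  obtain ⟨hT, hconf⟩ := mem_filter.1 hT
  obtain ⟨p, hp, rfl⟩ := (mem_spanningTrees_top.1 hT).exists_eq_parentGraph r
  refine ⟨p, mem_filter.2 ⟨Fintype.mem_piFinset.2 fun v => ?_, hp⟩, rfl⟩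
  rw [allowedParents]
  split_ifs with hv hvA
  · subst hv
    exact mem_singleton.2 hp.1
  · by_cases h : v = p v
    · exact h ▸ hAX hvA
    · exact hconf v hvA _ ⟨h, Or.inl rfl⟩
  · exact mem_univ _

theorem confined_prob_le (A X : Finset V) (r : V) (hAX : A ⊆ X) (hrX : r ∈ X) (hrA : r ∉ A) :
    ((((spanningTrees (⊤ : SimpleGraph V)).filter
          (fun T => ∀ u ∈ A, ∀ v : V, T.Adj u v → v ∈ X)).card : ℝ) /
        ((spanningTrees (⊤ : SimpleGraph V)).card : ℝ)) ≤
      ((X.card : ℝ) / Fintype.card V) ^ A.card := by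
  have hn : (0 : ℝ) < Fintype.card V := Nat.cast_pos.2 (Fintype.card_pos_iff.2 ⟨r⟩)
  have hnum := card_rootedMap A X r hAX hrX hrA
  have hden := card_rootedMap ∅ {r} r (empty_subset _) (mem_singleton_self r) (notMem_empty r)
  have hle : (_ : ℝ) ≤ _ := Nat.cast_le.2 (card_confined_le_card_rootedMap A X r hAX)
  have hge : (_ : ℝ) ≤ _ := Nat.cast_le.2 (card_rootedMap_le_card_spanningTrees ∅ {r} r)
  simp only [card_empty, zero_add, pow_one, pow_zero, one_mul] at hden
  rw [← hden] at hnum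
  have hpos : (0 : ℝ) < (((Fintype.piFinset (allowedParents ∅ {r} r)).filter
      (IsRootedMap r)).card : ℝ) := by
    refine pos_of_mul_pos_left ?_ hn.le
    rw [hden]
    positivity
  refine (div_le_div₀ (Nat.cast_nonneg _) hle hpos hge).trans_eq ?_
  rw [div_pow, div_eq_div_iff hpos.ne' (by positivity)]
  refine mul_right_cancel₀ hn.ne' ?_
  rw [mul_assoc, ← pow_succ, hnum]
  ring

theorem SimpleGraph.Connected.exists_adj_notMem {T : SimpleGraph V} (hT : T.Connected)
    {A : Finset V} (hA : A.Nonempty) (hA' : A ≠ univ) : ∃ u ∈ A, ∃ v ∉ A, T.Adj u v := by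
  obtain ⟨x, hx⟩ := hA
  obtain ⟨y, hy⟩ : ∃ y, y ∉ A := by
    by_contra! h
    exact hA' (eq_univ_of_forall h)
  obtain ⟨w⟩ := hT.preconnected x y
  obtain ⟨e, -, h1, h2⟩ := w.exists_boundary_dart (A : Set V) hx hy
  exact ⟨_, h1, _, h2, e.adj⟩

end SpanningTrees

/-- For a uniformly random spanning tree `T` of `K_n`, a set `A` of `a ≤ n/12` vertices
and a disjoint set `A'` of `⌊c·a⌋` vertices, the probability that every `T`-neighbor of
a vertex of `A` lies in `A ∪ A'` is at most `(2(1+c)a/n)^a`. -/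
theorem neighbors_confined_prob_le
    {V : Type*} [Fintype V] [DecidableEq V] (n : ℕ) (hn : Fintype.card V = n)
    (c : ℝ) (hc : 0 < c) (A A' : Finset V) (a : ℕ) (ha : A.card = a) (ha1 : 1 ≤ a)
    (hA' : A'.card = ⌊c * a⌋₊) (hdisj : Disjoint A A')
    (hsmall : (a : ℝ) ≤ n / 12) :
    ((((spanningTrees (⊤ : SimpleGraph V)).filter
          (fun T => ∀ u ∈ A, ∀ v : V, T.Adj u v → v ∈ A ∪ A')).card : ℝ) /
        ((spanningTrees (⊤ : SimpleGraph V)).card : ℝ))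
      ≤ (2 * (1 + c) * a / n) ^ a := by
  subst hn
  have hn : (0 : ℝ) < Fintype.card V := by
    have : (1 : ℝ) ≤ a := by exact_mod_cast ha1
    linarith
  have hAne : A.Nonempty := card_pos.1 (by omega)
  rcases A'.eq_empty_or_nonempty with rfl | ⟨r, hr⟩
  · have hAuniv : A ≠ univ := fun e => by
      have : (A.card : ℝ) = Fintype.card V := by rw [e, card_univ]
      rw [ha] at this
      linarith
    rw [filter_false_of_mem]
    · rw [card_empty, Nat.cast_zero, zero_div]
      positivity
    · intro T hT hconf
      obtain ⟨u, hu, v, hv, hadj⟩ :=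
        (mem_spanningTrees_top.1 hT).connected.exists_adj_notMem hAne hAuniv
      exact hv (by simpa using hconf u hu v hadj)
  · refine (confined_prob_le A (A ∪ A') r subset_union_left (mem_union_right _ hr)
      (disjoint_right.1 hdisj hr)).trans ?_
    rw [ha]
    have hca : 0 ≤ c * a := by positivity
    have hfloor : (⌊c * a⌋₊ : ℝ) ≤ c * a := Nat.floor_le hca
    have ha0 : (0 : ℝ) ≤ a := Nat.cast_nonneg a
    gcongr
    rw [card_union_of_disjoint hdisj, ha, hA', Nat.cast_add]
    linarith
end
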